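/- Let N ≥ 2, let n ≥ 1, let Nn/2 < s ≤ Nn, let Nn/s < p_1,…,p_N < ∞ and 1/p_1+⋯+1/p_N = 1/p. Set q_k = p_k s/(Nn) for k = 1,…,N. Then there exist weights w_1,…,w_N : ℝⁿ → [0,∞) with (w_1,…,w_N) ∈ A_{(q_1,…,q_N)} such that, for every function Ψ ∈ 𝒮(ℝ^{Nn}) with supp Ψ ⊂ {ξ : 1/2 ≤ |ξ| ≤ 2} and Σ_{k∈ℤ} Ψ(ξ/2^k) = 1 for all ξ ≠ 0, there is NO constant C > 0 for which the weak-type inequality ‖T_m(f_1,…,f_N)‖_{L^{p,∞}(ν_w)} ≤ C · (sup_{j∈ℤ} ‖m_j‖_{W^{(s/N,…,s/N)}(ℝ^{Nn})}) · Π_{k=1}^N ‖f_k‖_{L^{p_k}(w_k)} holds for all m ∈ L^∞(ℝ^{Nn}) and all f_1,…,f_N ∈ 𝒮(ℝⁿ), where m_j(ξ) = m(2^j ξ)Ψ(ξ) and ν_w = Π_{k=1}^N w_k^{p/p_k}. -/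

import Mathlib

open MeasureTheory Real Complex
open scoped RealInnerProductSpace ENNReal BigOperators

noncomputable section

/-- The Fourier transform `f̂(ξ) = ∫ e^{-ix·ξ} f(x) dx` on a Euclidean space. -/
def fint {ι : Type*} [Fintype ι] (f : EuclideanSpace ℝ ι → ℂ) (ξ : EuclideanSpace ℝ ι) : ℂ :=
  ∫ x, Complex.exp (-(Complex.I * ((⟪x, ξ⟫ : ℝ) : ℂ))) * f x

/-- The `k`-th block `ξ_k ∈ ℝⁿ` of `ξ ∈ ℝ^{Nn} = (ℝⁿ)^N`. -/
def blk {N n : ℕ} (ξ : EuclideanSpace ℝ (Fin N × Fin n)) (k : Fin N) :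
    EuclideanSpace ℝ (Fin n) :=
  (WithLp.equiv 2 (Fin n → ℝ)).symm (fun i => ξ (k, i))

/-- The `N`-linear Fourier multiplier operator
`T_m(f₁,…,f_N)(x) = (2π)^{-Nn} ∫ e^{ix·(ξ₁+⋯+ξ_N)} m(ξ) f̂₁(ξ₁)⋯f̂_N(ξ_N) dξ`. -/
def Tm {N n : ℕ} (m : EuclideanSpace ℝ (Fin N × Fin n) → ℂ)
    (f : Fin N → (EuclideanSpace ℝ (Fin n) → ℂ)) (x : EuclideanSpace ℝ (Fin n)) : ℂ :=
  (((2 * π) ^ (N * n) : ℝ) : ℂ)⁻¹ *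
    ∫ ξ, Complex.exp (Complex.I * ((⟪x, ∑ k, blk ξ k⟫ : ℝ) : ℂ)) * m ξ *
      ∏ k, fint (f k) (blk ξ k)

/-- The product-type Sobolev (quasi-)norm
`‖F‖_{W^{(t₁,…,t_N)}(ℝ^{Nn})} = (∫ Π_k (1+|ξ_k|²)^{t_k} |F̂(ξ)|² dξ)^{1/2}`,
with values in `ℝ≥0∞`. -/
def sobolevProd {N n : ℕ} (t : Fin N → ℝ)
    (F : EuclideanSpace ℝ (Fin N × Fin n) → ℂ) : ℝ≥0∞ :=
  (∫⁻ ξ : EuclideanSpace ℝ (Fin N × Fin n),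
    ENNReal.ofReal ((∏ k, (1 + ‖blk ξ k‖ ^ 2) ^ (t k)) * ‖fint F ξ‖ ^ 2)) ^ ((1 : ℝ) / 2)

/-- The weighted Lebesgue (quasi-)norm `‖f‖_{L^q(w)} = (∫ |f|^q w dx)^{1/q}`,
with values in `ℝ≥0∞`. -/
def wLp {n : ℕ} (q : ℝ) (w : EuclideanSpace ℝ (Fin n) → ℝ)
    (f : EuclideanSpace ℝ (Fin n) → ℂ) : ℝ≥0∞ :=
  (∫⁻ x, ENNReal.ofReal (‖f x‖ ^ q * w x)) ^ (1 / q)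

/-- The axis-parallel cube with lower corner `c` and side length `h` in `ℝⁿ`. -/
def cube (n : ℕ) (c : Fin n → ℝ) (h : ℝ) : Set (EuclideanSpace ℝ (Fin n)) :=
  {x | ∀ i, c i ≤ x i ∧ x i ≤ c i + h}

/-- The multilinear Muckenhoupt class `A_{(r₁,…,r_N)}`: here `r : Fin N → ℝ` is the tuple
of exponents and `q` the combined exponent with `1/q = Σ 1/r k`.  Membership means that
`sup_Q (|Q|⁻¹ ∫_Q Π_k w_k^{q/r_k})^{1/q} Π_k (|Q|⁻¹ ∫_Q w_k^{1-r_k'})^{1/r_k'} < ∞`,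
where `1 - r_k' = 1 - r_k/(r_k - 1)` and `1/r_k' = 1 - 1/r_k`. -/
def IsMultiAp (n N : ℕ) (q : ℝ) (r : Fin N → ℝ)
    (w : Fin N → EuclideanSpace ℝ (Fin n) → ℝ) : Prop :=
  ∃ A : ℝ, ∀ (c : Fin n → ℝ) (h : ℝ), 0 < h →
    ((h ^ n)⁻¹ * ∫ x in cube n c h, ∏ k, w k x ^ (q / r k)) ^ (1 / q) *
      ∏ k, ((h ^ n)⁻¹ *
        ∫ x in cube n c h, w k x ^ (1 - r k / (r k - 1))) ^ (1 - 1 / r k) ≤ A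


/-! ### The product weights `∏ i, (1 + |x i|) ^ γ` -/

lemma continuous_one_add_abs_rpow (γ : ℝ) : Continuous fun t : ℝ => (1 + |t|) ^ γ :=
  (continuous_const.add continuous_abs).rpow_const fun t =>
    Or.inl (add_pos_of_pos_of_nonneg one_pos (abs_nonneg t)).ne'

lemma average_Icc_le_of_le {f : ℝ → ℝ} (hf : Continuous f) {c h B : ℝ} (hh : 0 < h)
    (hB : ∀ t ∈ Set.Icc c (c + h), f t ≤ B) : h⁻¹ * ∫ t in Set.Icc c (c + h), f t ≤ B := by
  have h1 : ∫ t in Set.Icc c (c + h), f t ≤ ∫ _ in Set.Icc c (c + h), B :=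
    setIntegral_mono_on hf.continuousOn.integrableOn_Icc
      continuous_const.continuousOn.integrableOn_Icc measurableSet_Icc hB
  have h2 : ∫ _ in Set.Icc c (c + h), B = h * B := by
    simp [hh.le]
  rw [h2] at h1
  rw [inv_mul_le_iff₀ hh]
  exact h1

lemma intervalIntegral_one_add_abs_rpow_le {γ M : ℝ} (hγ : -1 < γ) (hM : 0 ≤ M) :
    ∫ t in (-M)..M, (1 + |t|) ^ γ ≤ 2 * ((1 + M) ^ (γ + 1) / (γ + 1)) := by
  have hc := continuous_one_add_abs_rpow γ
  have hpos : ∫ t in (0 : ℝ)..M, (1 + |t|) ^ γ ≤ (1 + M) ^ (γ + 1) / (γ + 1) := by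
    have h1 : ∫ t in (0 : ℝ)..M, (1 + |t|) ^ γ = ∫ t in (0 : ℝ)..M, (1 + t) ^ γ := by
      refine intervalIntegral.integral_congr fun t ht => ?_
      rw [Set.uIcc_of_le hM] at ht
      simp only [abs_of_nonneg ht.1]
    rw [h1, intervalIntegral.integral_comp_add_left (fun u => u ^ γ) 1,
      integral_rpow (Or.inl hγ)]
    have : 0 < γ + 1 := by linarith
    gcongr
    simp
  have hneg : ∫ t in (-M)..0, (1 + |t|) ^ γ = ∫ t in (0 : ℝ)..M, (1 + |t|) ^ γ := by
    have := intervalIntegral.integral_comp_neg (a := 0) (b := M) fun t : ℝ => (1 + |t|) ^ γ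
    simp only [abs_neg, neg_zero] at this
    exact this.symm
  rw [← intervalIntegral.integral_add_adjacent_intervals (b := 0)
    (hc.intervalIntegrable _ _) (hc.intervalIntegrable _ _), hneg]
  linarith

lemma exists_average_one_add_abs_rpow_le {γ : ℝ} (hγ : -1 < γ) :
    ∃ C : ℝ, 0 ≤ C ∧ ∀ c h : ℝ, 0 < h →
      h⁻¹ * ∫ t in Set.Icc c (c + h), (1 + |t|) ^ γ ≤ C * (1 + |c| + h) ^ γ := by
  have hc := continuous_one_add_abs_rpow γ
  have hγ1 : 0 < γ + 1 := by linarith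
  rcases le_or_gt 0 γ with h0 | h0
  · refine ⟨1, zero_le_one, fun c h hh => ?_⟩
    refine average_Icc_le_of_le hc hh fun t ht => ?_
    rw [one_mul]
    refine Real.rpow_le_rpow (by positivity) ?_ h0
    have : |t| ≤ |c| + h := by
      rw [abs_le]
      constructor <;> linarith [ht.1, ht.2, neg_abs_le c, le_abs_self c]
    linarith
  refine ⟨(1 / 3) ^ γ + 12 / (γ + 1), by positivity, fun c h hh => ?_⟩
  have hM : 0 < 1 + |c| + h := by positivity
  have hMγ : 0 < (1 + |c| + h) ^ γ := by positivity
  rcases le_or_gt h ((1 + |c|) / 2) with hc2 | hc2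
  · have : h⁻¹ * ∫ t in Set.Icc c (c + h), (1 + |t|) ^ γ ≤ (1 / 3) ^ γ * (1 + |c| + h) ^ γ := by
      refine average_Icc_le_of_le hc hh fun t ht => ?_
      rw [← Real.mul_rpow (by norm_num) hM.le]
      refine Real.rpow_le_rpow_of_nonpos (by positivity) ?_ h0.le
      have : |c| ≤ |t| + h := by
        rw [abs_le]
        constructor <;> linarith [ht.1, ht.2, neg_abs_le t, le_abs_self t]
      linarith
    have : 0 ≤ 12 / (γ + 1) * (1 + |c| + h) ^ γ := by positivity
    linarith
  · set M := 1 + |c| + h with hMdef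
    have hM1 : 1 ≤ M := by linarith [abs_nonneg c]
    have h1 : ∫ t in Set.Icc c (c + h), (1 + |t|) ^ γ ≤ ∫ t in (-M)..M, (1 + |t|) ^ γ := by
      rw [intervalIntegral.integral_of_le (by linarith), ← integral_Icc_eq_integral_Ioc]
      refine setIntegral_mono_set hc.continuousOn.integrableOn_Icc
        (Filter.Eventually.of_forall fun t => by positivity)
        (Set.Icc_subset_Icc ?_ ?_).eventuallyLE
      · linarith [neg_abs_le c]
      · linarith [le_abs_self c]
    have h2 := intervalIntegral_one_add_abs_rpow_le hγ hM.le
    have h3 : (1 + M) ^ (γ + 1) ≤ 2 * (M * M ^ γ) := by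
      calc (1 + M) ^ (γ + 1) ≤ (2 * M) ^ (γ + 1) :=
            Real.rpow_le_rpow (by linarith) (by linarith) hγ1.le
        _ = 2 ^ (γ + 1) * (M * M ^ γ) := by
            rw [Real.mul_rpow (by norm_num) hM.le, Real.rpow_add_one hM.ne' γ, mul_comm M]
        _ ≤ 2 ^ (1 : ℝ) * (M * M ^ γ) := by
            gcongr
            · norm_num
            · linarith
        _ = 2 * (M * M ^ γ) := by rw [Real.rpow_one]
    have h4 : M * M ^ γ ≤ (3 * h) * M ^ γ := by
      gcongr
      linarith
    have h5 : 0 ≤ (1 / 3 : ℝ) ^ γ * M ^ γ := by positivity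
    rw [inv_mul_le_iff₀ hh]
    calc ∫ t in Set.Icc c (c + h), (1 + |t|) ^ γ
        ≤ 2 * ((1 + M) ^ (γ + 1) / (γ + 1)) := h1.trans h2
      _ ≤ 2 * ((2 * ((3 * h) * M ^ γ)) / (γ + 1)) := by
          gcongr
          linarith
      _ = h * (12 / (γ + 1) * M ^ γ) := by ring
      _ ≤ h * (((1 / 3) ^ γ + 12 / (γ + 1)) * M ^ γ) := by
          gcongr
          linarith [Real.rpow_nonneg (by norm_num : (0 : ℝ) ≤ 1 / 3) γ]

/-- The product weight `∏ i, (1 + |x i|) ^ γ` on `ℝⁿ`. -/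
def prodWeight {n : ℕ} (γ : ℝ) (x : EuclideanSpace ℝ (Fin n)) : ℝ :=
  ∏ i, (1 + |x i|) ^ γ

lemma prodWeight_pos {n : ℕ} (γ : ℝ) (x : EuclideanSpace ℝ (Fin n)) : 0 < prodWeight γ x :=
  Finset.prod_pos fun _ _ => by positivity

lemma continuous_prodWeight {n : ℕ} (γ : ℝ) : Continuous (prodWeight γ (n := n)) := by
  unfold prodWeight
  refine continuous_finsetProd _ fun i _ => (continuous_one_add_abs_rpow γ).comp ?_
  fun_prop

lemma prodWeight_rpow {n : ℕ} (γ δ : ℝ) (x : EuclideanSpace ℝ (Fin n)) :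
    prodWeight γ x ^ δ = prodWeight (γ * δ) x := by
  unfold prodWeight
  rw [← Real.finsetProd_rpow _ _ fun i _ => by positivity]
  exact Finset.prod_congr rfl fun i _ => by rw [Real.rpow_mul (by positivity)]

lemma prod_prodWeight {n : ℕ} {ι : Type*} (s : Finset ι) (γ : ι → ℝ)
    (x : EuclideanSpace ℝ (Fin n)) :
    ∏ k ∈ s, prodWeight (γ k) x = prodWeight (∑ k ∈ s, γ k) x := by
  unfold prodWeight
  rw [Finset.prod_comm]
  exact Finset.prod_congr rfl fun i _ => (Real.rpow_sum_of_pos (by positivity) _ _).symm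

lemma prodWeight_sub_le {n : ℕ} {γ : ℝ} (hγ : γ ≤ 0) (x a : EuclideanSpace ℝ (Fin n)) :
    prodWeight γ x ≤ prodWeight γ a * prodWeight (-γ) (x - a) := by
  unfold prodWeight
  rw [← Finset.prod_mul_distrib]
  refine Finset.prod_le_prod (fun i _ => by positivity) fun i _ => ?_
  have h1 : (1 + |x i|) * (1 + |(x - a) i|) ≥ 1 + |a i| := by
    have : |a i| ≤ |x i| + |(x - a) i| := by
      have := abs_sub (x i) ((x - a) i)
      simpa using this
    nlinarith [abs_nonneg (x i), abs_nonneg ((x - a) i)]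
  have h2 := Real.rpow_le_rpow_of_nonpos (by positivity) h1 hγ
  rw [Real.mul_rpow (by positivity) (by positivity)] at h2
  rw [Real.rpow_neg (by positivity), ← div_eq_mul_inv, le_div_iff₀ (by positivity)]
  exact h2

lemma integral_cube_prodWeight {n : ℕ} (γ : ℝ) (c : Fin n → ℝ) (h : ℝ) :
    ∫ x in cube n c h, prodWeight γ x =
      ∏ i, ∫ t in Set.Icc (c i) (c i + h), (1 + |t|) ^ γ := by
  have hcube : cube n c h =
      WithLp.ofLp ⁻¹' (Set.univ.pi fun i => Set.Icc (c i) (c i + h)) := by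
    ext x
    simp [cube, Pi.le_def, forall_and]
  have h1 := (PiLp.volume_preserving_ofLp (Fin n)).setIntegral_preimage_emb
    (MeasurableEquiv.toLp 2 (Fin n → ℝ)).symm.measurableEmbedding
    (fun y : Fin n → ℝ => ∏ i, (1 + |y i|) ^ γ)
    (Set.univ.pi fun i => Set.Icc (c i) (c i + h))
  rw [hcube]
  refine h1.trans ?_
  rw [volume_pi, Measure.restrict_pi_pi]
  exact integral_fintype_prod_eq_prod (fun (_ : Fin n) (t : ℝ) => (1 + |t|) ^ γ)

lemma exists_average_cube_prodWeight_le (n : ℕ) {γ : ℝ} (hγ : -1 < γ) :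
    ∃ C : ℝ, 0 ≤ C ∧ ∀ (c : Fin n → ℝ) (h : ℝ), 0 < h →
      (h ^ n)⁻¹ * ∫ x in cube n c h, prodWeight γ x ≤ C * (∏ i, (1 + |c i| + h)) ^ γ := by
  obtain ⟨C, hC, hle⟩ := exists_average_one_add_abs_rpow_le hγ
  refine ⟨C ^ n, by positivity, fun c h hh => ?_⟩
  calc (h ^ n)⁻¹ * ∫ x in cube n c h, prodWeight γ x
      = ∏ i, (h⁻¹ * ∫ t in Set.Icc (c i) (c i + h), (1 + |t|) ^ γ) := by
        rw [integral_cube_prodWeight, Finset.prod_mul_distrib]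
        simp
    _ ≤ ∏ i, (C * (1 + |c i| + h) ^ γ) := by
        refine Finset.prod_le_prod (fun i _ => mul_nonneg (by positivity) ?_)
          fun i _ => hle (c i) h hh
        exact integral_nonneg fun t => by positivity
    _ = C ^ n * (∏ i, (1 + |c i| + h)) ^ γ := by
        rw [Finset.prod_mul_distrib, Real.finsetProd_rpow _ _ fun i _ => by positivity]
        simp

/-- Product weights belong to the multilinear Muckenhoupt class as soon as all the powers that
occur in its definition are locally integrable. -/
lemma isMultiAp_prodWeight {n N : ℕ} {q : ℝ} {r β : Fin N → ℝ} (hq : 0 < q)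
    (hr : ∀ k, 1 < r k) (hβ : -1 < ∑ k, β k * (q / r k))
    (hβ' : ∀ k, -1 < β k * (1 - r k / (r k - 1))) :
    IsMultiAp n N q r fun k => prodWeight (β k) := by
  obtain ⟨C₀, hC₀, h₀⟩ := exists_average_cube_prodWeight_le n hβ
  choose C hC hle using fun k => exists_average_cube_prodWeight_le n (hβ' k)
  refine ⟨C₀ ^ (1 / q) * ∏ k, C k ^ (1 - 1 / r k), fun c h hh => ?_⟩
  set M : ℝ := ∏ i, (1 + |c i| + h) with hM
  have hMpos : 0 < M := Finset.prod_pos fun i _ => by positivity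
  have hexp : ∀ k, 0 ≤ 1 - 1 / r k := fun k => by
    rw [sub_nonneg, div_le_one (by linarith [hr k])]
    exact (hr k).le
  have hnn : ∀ γ : ℝ, 0 ≤ (h ^ n)⁻¹ * ∫ x in cube n c h, prodWeight γ x := fun γ =>
    mul_nonneg (by positivity) (integral_nonneg fun x => (prodWeight_pos γ x).le)
  simp only [prodWeight_rpow, prod_prodWeight]
  calc _ ≤ (C₀ * M ^ (∑ k, β k * (q / r k))) ^ (1 / q) *
        ∏ k, (C k * M ^ (β k * (1 - r k / (r k - 1)))) ^ (1 - 1 / r k) := by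
        refine mul_le_mul (Real.rpow_le_rpow (hnn _) (h₀ c h hh) (by positivity))
          (Finset.prod_le_prod (fun k _ => Real.rpow_nonneg (hnn _) _) fun k _ =>
            Real.rpow_le_rpow (hnn _) (hle k c h hh) (hexp k))
          (Finset.prod_nonneg fun k _ => Real.rpow_nonneg (hnn _) _)
          (by positivity)
    _ = C₀ ^ (1 / q) * (∏ k, C k ^ (1 - 1 / r k)) *
        (M ^ (∑ k, β k / r k) * ∏ k, M ^ (-(β k / r k))) := by
        have e1 : (M ^ (∑ k, β k * (q / r k))) ^ (1 / q) = M ^ (∑ k, β k / r k) := by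
          rw [← Real.rpow_mul hMpos.le, Finset.sum_mul]
          congr 1
          exact Finset.sum_congr rfl fun k _ => by field_simp
        have e2 : ∀ k, (M ^ (β k * (1 - r k / (r k - 1)))) ^ (1 - 1 / r k) =
            M ^ (-(β k / r k)) := fun k => by
          rw [← Real.rpow_mul hMpos.le]
          congr 1
          have h1 : r k - 1 ≠ 0 := by linarith [hr k]
          have h2 : r k ≠ 0 := by linarith [hr k]
          field_simp
          ring
        rw [Real.mul_rpow hC₀ (by positivity), e1]
        simp_rw [fun k => Real.mul_rpow (hC k)
          (Real.rpow_nonneg hMpos.le (β k * (1 - r k / (r k - 1)))) (z := 1 - 1 / r k), e2]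
        rw [Finset.prod_mul_distrib]
        ring
    _ = C₀ ^ (1 / q) * ∏ k, C k ^ (1 - 1 / r k) := by
        rw [← Real.rpow_sum_of_pos hMpos, ← Real.rpow_add hMpos]
        simp

/-! ### Fourier transforms and Sobolev norms of modulated functions -/

lemma fint_eq_fourier {ι : Type*} [Fintype ι] (f : EuclideanSpace ℝ ι → ℂ)
    (ξ : EuclideanSpace ℝ ι) :
    fint f ξ = FourierTransform.fourier f ((2 * π)⁻¹ • ξ) := by
  rw [Real.fourier_eq', fint]
  refine integral_congr_ae (Filter.Eventually.of_forall fun x => ?_)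
  simp only [inner_smul_right, smul_eq_mul]
  congr 2
  have : -2 * π * ((2 * π)⁻¹ * ⟪x, ξ⟫) = -⟪x, ξ⟫ := by
    have := Real.pi_ne_zero
    field_simp
  rw [this]
  push_cast
  ring

lemma continuous_fint {ι : Type*} [Fintype ι] (G : SchwartzMap (EuclideanSpace ℝ ι) ℂ) :
    Continuous (fint G) := by
  have : fint G = fun ξ => FourierTransform.fourier G ((2 * π)⁻¹ • ξ) := by
    ext ξ
    rw [fint_eq_fourier, SchwartzMap.fourier_coe]
  rw [this]
  exact (FourierTransform.fourier G).continuous.comp (continuous_const_smul _)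

lemma exists_one_add_norm_pow_mul_fint_le {ι : Type*} [Fintype ι]
    (G : SchwartzMap (EuclideanSpace ℝ ι) ℂ) (L : ℕ) :
    ∃ C : ℝ, ∀ ξ, (1 + ‖ξ‖) ^ L * ‖fint G ξ‖ ≤ C := by
  refine ⟨(2 * π) ^ L * (2 ^ L * ((Finset.Iic (L, 0)).sup
    fun m => SchwartzMap.seminorm ℂ m.1 m.2) (FourierTransform.fourier G)), fun ξ => ?_⟩
  have h1 := SchwartzMap.one_add_le_sup_seminorm_apply (𝕜 := ℂ) (m := (L, 0)) (k := L) (n := 0)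
    le_rfl le_rfl (FourierTransform.fourier G) ((2 * π)⁻¹ • ξ)
  rw [norm_iteratedFDeriv_zero, SchwartzMap.fourier_coe, ← fint_eq_fourier, norm_smul,
    Real.norm_of_nonneg (by positivity)] at h1
  have hpi : 1 ≤ 2 * π := by linarith [Real.pi_gt_three]
  have h2 : 1 + ‖ξ‖ ≤ 2 * π * (1 + (2 * π)⁻¹ * ‖ξ‖) := by
    have : 2 * π * (1 + (2 * π)⁻¹ * ‖ξ‖) = 2 * π + ‖ξ‖ := by
      field_simp
    rw [this]
    linarith
  calc (1 + ‖ξ‖) ^ L * ‖fint G ξ‖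
      ≤ (2 * π * (1 + (2 * π)⁻¹ * ‖ξ‖)) ^ L * ‖fint G ξ‖ := by gcongr
    _ = (2 * π) ^ L * ((1 + (2 * π)⁻¹ * ‖ξ‖) ^ L * ‖fint G ξ‖) := by rw [mul_pow]; ring
    _ ≤ _ := by gcongr

lemma fint_modulation {ι : Type*} [Fintype ι] (b : EuclideanSpace ℝ ι)
    (G : EuclideanSpace ℝ ι → ℂ) (ξ : EuclideanSpace ℝ ι) :
    fint (fun η => Complex.exp (Complex.I * ((⟪b, η⟫ : ℝ) : ℂ)) * G η) ξ = fint G (ξ - b) := by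
  unfold fint
  refine integral_congr_ae (Filter.Eventually.of_forall fun x => ?_)
  simp only [inner_sub_right, ← mul_assoc, ← Complex.exp_add, real_inner_comm x b]
  congr 2
  push_cast
  ring

lemma fint_comp_sub {ι : Type*} [Fintype ι] (a : EuclideanSpace ℝ ι)
    (G : EuclideanSpace ℝ ι → ℂ) (ξ : EuclideanSpace ℝ ι) :
    fint (fun x => G (x - a)) ξ = Complex.exp (-(Complex.I * ((⟪a, ξ⟫ : ℝ) : ℂ))) * fint G ξ := by
  unfold fint
  rw [← integral_const_mul, ← integral_add_right_eq_self _ a]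
  refine integral_congr_ae (Filter.Eventually.of_forall fun x => ?_)
  simp only [inner_add_left, add_sub_cancel_right, ← mul_assoc, ← Complex.exp_add]
  congr 2
  push_cast
  ring

lemma continuous_blk {N n : ℕ} (k : Fin N) :
    Continuous fun ξ : EuclideanSpace ℝ (Fin N × Fin n) => blk ξ k := by
  unfold blk
  refine (PiLp.continuous_toLp 2 _).comp (continuous_pi fun i => ?_)
  fun_prop

lemma blk_add {N n : ℕ} (ξ η : EuclideanSpace ℝ (Fin N × Fin n)) (k : Fin N) :
    blk (ξ + η) k = blk ξ k + blk η k := by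
  ext i
  simp [blk]

lemma blk_smul {N n : ℕ} (c : ℝ) (ξ : EuclideanSpace ℝ (Fin N × Fin n)) (k : Fin N) :
    blk (c • ξ) k = c • blk ξ k := by
  ext i
  simp [blk]

lemma norm_blk_le {N n : ℕ} (ξ : EuclideanSpace ℝ (Fin N × Fin n)) (k : Fin N) :
    ‖blk ξ k‖ ≤ ‖ξ‖ := by
  rw [EuclideanSpace.norm_eq, EuclideanSpace.norm_eq, Fintype.sum_prod_type]
  refine Real.sqrt_le_sqrt ?_
  simp only [blk, WithLp.equiv_symm_apply]
  exact Finset.single_le_sum (f := fun k => ∑ i, ‖ξ (k, i)‖ ^ 2)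
    (fun k _ => Finset.sum_nonneg fun i _ => by positivity) (Finset.mem_univ k)

lemma sobolevProd_lt_top {N n : ℕ} {t : Fin N → ℝ} (ht : ∀ k, 0 ≤ t k)
    (G : SchwartzMap (EuclideanSpace ℝ (Fin N × Fin n)) ℂ) : sobolevProd t G < ⊤ := by
  refine ENNReal.rpow_lt_top_of_nonneg (by norm_num) (ne_of_lt ?_)
  set d : ℕ := Module.finrank ℝ (EuclideanSpace ℝ (Fin N × Fin n)) with hd
  obtain ⟨L, hL⟩ := exists_nat_ge (∑ k, 2 * t k + (d + 1))
  obtain ⟨C, hC⟩ := exists_one_add_norm_pow_mul_fint_le G L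
  have hfin : ∫⁻ ξ : EuclideanSpace ℝ (Fin N × Fin n),
      ENNReal.ofReal ((1 + ‖ξ‖) ^ (-((d : ℝ) + 1))) < ⊤ :=
    finite_integral_one_add_norm (by linarith)
  refine lt_of_le_of_lt (lintegral_mono fun ξ => ?_)
    (lt_of_eq_of_lt (lintegral_const_mul' (ENNReal.ofReal (C ^ 2)) _ ENNReal.ofReal_ne_top)
      (ENNReal.mul_lt_top ENNReal.ofReal_lt_top hfin))
  rw [← ENNReal.ofReal_mul (by positivity)]
  refine ENNReal.ofReal_le_ofReal ?_
  have h1 : ∏ k, (1 + ‖blk ξ k‖ ^ 2) ^ t k ≤ (1 + ‖ξ‖) ^ (∑ k, 2 * t k) := by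
    rw [Real.rpow_sum_of_pos (by positivity)]
    refine Finset.prod_le_prod (fun k _ => by positivity) fun k _ => ?_
    rw [Real.rpow_mul (by positivity)]
    refine Real.rpow_le_rpow (by positivity) ?_ (ht k)
    rw [Real.rpow_two]
    nlinarith [norm_blk_le ξ k, norm_nonneg (blk ξ k), norm_nonneg ξ]
  have h2 : (1 + ‖ξ‖) ^ (∑ k, 2 * t k) ≤
      (1 + ‖ξ‖) ^ (-((d : ℝ) + 1)) * ((1 + ‖ξ‖) ^ L) ^ 2 := by
    rw [← Real.rpow_natCast, ← Real.rpow_natCast, ← Real.rpow_mul (by positivity),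
      ← Real.rpow_add (by positivity)]
    refine Real.rpow_le_rpow_of_exponent_le (by linarith [norm_nonneg ξ]) ?_
    have : (0 : ℝ) ≤ L := L.cast_nonneg
    push_cast
    linarith
  calc (∏ k, (1 + ‖blk ξ k‖ ^ 2) ^ t k) * ‖fint G ξ‖ ^ 2
      ≤ (1 + ‖ξ‖) ^ (-((d : ℝ) + 1)) * ((1 + ‖ξ‖) ^ L) ^ 2 * ‖fint G ξ‖ ^ 2 := by
        gcongr
        exact h1.trans h2
    _ = ((1 + ‖ξ‖) ^ L * ‖fint G ξ‖) ^ 2 * (1 + ‖ξ‖) ^ (-((d : ℝ) + 1)) := by ring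
    _ ≤ C ^ 2 * (1 + ‖ξ‖) ^ (-((d : ℝ) + 1)) := by
        gcongr
        exact hC ξ

lemma sobolevProd_modulation_le {N n : ℕ} {t : Fin N → ℝ} (ht : ∀ k, 0 ≤ t k)
    (b : EuclideanSpace ℝ (Fin N × Fin n)) (G : EuclideanSpace ℝ (Fin N × Fin n) → ℂ) :
    sobolevProd t (fun η => Complex.exp (Complex.I * ((⟪b, η⟫ : ℝ) : ℂ)) * G η) ≤
      ENNReal.ofReal (∏ k, (2 * (1 + ‖blk b k‖ ^ 2)) ^ t k) ^ ((1 : ℝ) / 2) *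
        sobolevProd t G := by
  unfold sobolevProd
  rw [← ENNReal.mul_rpow_of_nonneg _ _ (by norm_num : (0 : ℝ) ≤ 1 / 2),
    ← lintegral_const_mul' _ _ ENNReal.ofReal_ne_top]
  refine ENNReal.rpow_le_rpow ?_ (by norm_num)
  simp only [fint_modulation]
  rw [← lintegral_add_right_eq_self _ b]
  refine lintegral_mono fun ξ => ?_
  rw [← ENNReal.ofReal_mul (Finset.prod_nonneg fun k _ => by positivity), add_sub_cancel_right,
    ← mul_assoc, ← Finset.prod_mul_distrib]
  refine ENNReal.ofReal_le_ofReal (mul_le_mul_of_nonneg_right ?_ (by positivity))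
  refine Finset.prod_le_prod (fun k _ => by positivity) fun k _ => ?_
  rw [← Real.mul_rpow (by positivity) (by positivity), blk_add]
  refine Real.rpow_le_rpow (by positivity) ?_ (ht k)
  have h1 := norm_add_le (blk ξ k) (blk b k)
  have h2 : ‖blk ξ k + blk b k‖ ^ 2 ≤ (‖blk ξ k‖ + ‖blk b k‖) ^ 2 := by gcongr
  nlinarith [sq_nonneg (‖blk ξ k‖ - ‖blk b k‖), sq_nonneg (‖blk ξ k‖ * ‖blk b k‖)]

lemma sobolevProd_zero {N n : ℕ} (t : Fin N → ℝ) :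
    sobolevProd t (fun _ : EuclideanSpace ℝ (Fin N × Fin n) => (0 : ℂ)) = 0 := by
  simp [sobolevProd, fint]

/-- The vector of `(ℝⁿ)^N` whose `k₀`-th block is `a` and whose other blocks vanish. -/
def inclBlk {N n : ℕ} (k₀ : Fin N) (a : EuclideanSpace ℝ (Fin n)) :
    EuclideanSpace ℝ (Fin N × Fin n) :=
  WithLp.toLp 2 fun x => if x.1 = k₀ then a x.2 else 0

lemma blk_inclBlk {N n : ℕ} (k₀ k : Fin N) (a : EuclideanSpace ℝ (Fin n)) :
    blk (inclBlk k₀ a) k = if k = k₀ then a else 0 := by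
  ext i
  split_ifs with h <;> simp [blk, inclBlk, h]

lemma inner_inclBlk {N n : ℕ} (k₀ : Fin N) (a : EuclideanSpace ℝ (Fin n))
    (ξ : EuclideanSpace ℝ (Fin N × Fin n)) : ⟪inclBlk k₀ a, ξ⟫ = ⟪a, blk ξ k₀⟫ := by
  simp [PiLp.inner_apply, inclBlk, blk, Fintype.sum_prod_type]

/-! ### The multipliers and the test functions -/

lemma Tm_modulation {N n : ℕ} (k₀ : Fin N) (a : EuclideanSpace ℝ (Fin n))
    (Φ : EuclideanSpace ℝ (Fin N × Fin n) → ℂ) (g : EuclideanSpace ℝ (Fin n) → ℂ)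
    (x : EuclideanSpace ℝ (Fin n)) :
    Tm (fun ξ => Complex.exp (Complex.I * ((⟪inclBlk k₀ a, ξ⟫ : ℝ) : ℂ)) * Φ ξ)
      (fun k => if k = k₀ then fun y => g (y - a) else g) x = Tm Φ (fun _ => g) x := by
  unfold Tm
  congr 1
  refine integral_congr_ae (Filter.Eventually.of_forall fun ξ => ?_)
  have h1 : ∏ k, fint (if k = k₀ then fun y => g (y - a) else g) (blk ξ k) =
      Complex.exp (-(Complex.I * ((⟪a, blk ξ k₀⟫ : ℝ) : ℂ))) * ∏ k, fint g (blk ξ k) := by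
    rw [← Finset.mul_prod_erase _ _ (Finset.mem_univ k₀),
      ← Finset.mul_prod_erase _ (fun k => fint g (blk ξ k)) (Finset.mem_univ k₀), if_pos rfl,
      fint_comp_sub, mul_assoc]
    congr 2
    refine Finset.prod_congr rfl fun k hk => ?_
    rw [if_neg (Finset.ne_of_mem_erase hk)]
  have h2 : Complex.exp (Complex.I * ((⟪a, blk ξ k₀⟫ : ℝ) : ℂ)) *
      Complex.exp (-(Complex.I * ((⟪a, blk ξ k₀⟫ : ℝ) : ℂ))) = 1 := by
    rw [← Complex.exp_add, add_neg_cancel, Complex.exp_zero]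
  simp only [h1, inner_inclBlk]
  linear_combination (Complex.exp (Complex.I * ((⟪x, ∑ k, blk ξ k⟫ : ℝ) : ℂ)) * Φ ξ *
    ∏ k, fint g (blk ξ k)) * h2

lemma continuous_Tm {N n : ℕ} {Φ : EuclideanSpace ℝ (Fin N × Fin n) → ℂ} (hΦ : Continuous Φ)
    (hΦc : HasCompactSupport Φ) (f : Fin N → SchwartzMap (EuclideanSpace ℝ (Fin n)) ℂ) :
    Continuous (Tm Φ fun k => ⇑(f k)) := by
  have hP : Continuous fun ξ : EuclideanSpace ℝ (Fin N × Fin n) =>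
      ∏ k, fint (f k) (blk ξ k) :=
    continuous_finsetProd _ fun k _ => (continuous_fint (f k)).comp (continuous_blk k)
  have hS : Continuous fun ξ : EuclideanSpace ℝ (Fin N × Fin n) => ∑ k, blk ξ k :=
    continuous_finsetSum _ fun k _ => continuous_blk k
  refine continuous_const.mul (continuous_of_dominated
    (bound := fun ξ => ‖Φ ξ * ∏ k, fint (f k) (blk ξ k)‖) (fun x => ?_) (fun x => ?_) ?_ ?_)
  · exact Continuous.aestronglyMeasurable (by fun_prop)
  · refine Filter.Eventually.of_forall fun ξ => ?_
    rw [mul_assoc, norm_mul, mul_comm Complex.I, Complex.norm_exp_ofReal_mul_I, one_mul]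
  · exact ((hΦ.mul hP).integrable_of_hasCompactSupport hΦc.mul_right).norm
  · exact Filter.Eventually.of_forall fun ξ => by fun_prop

lemma exists_cutoff_Tm_ne_zero {N n : ℕ} (hN : 0 < N) (hn : 0 < n)
    (g : SchwartzMap (EuclideanSpace ℝ (Fin n)) ℂ) (hg : 0 < (fint g 0 ^ N).re) :
    ∃ Φ : EuclideanSpace ℝ (Fin N × Fin n) → ℝ, ContDiff ℝ (⊤ : ℕ∞) Φ ∧ HasCompactSupport Φ ∧
      (∃ ρ : ℝ, 0 < ρ ∧ ∀ ξ, ‖ξ‖ < ρ → Φ ξ = 0) ∧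
      Tm (fun ξ => (Φ ξ : ℂ)) (fun _ : Fin N => ⇑g) 0 ≠ 0 := by
  have : NeZero N := ⟨hN.ne'⟩
  have : NeZero n := ⟨hn.ne'⟩
  have : Nontrivial (EuclideanSpace ℝ (Fin N × Fin n)) := inferInstance
  set P : EuclideanSpace ℝ (Fin N × Fin n) → ℂ := fun ξ => ∏ k, fint g (blk ξ k) with hPdef
  have hP : Continuous P :=
    continuous_finsetProd _ fun k _ => (continuous_fint g).comp (continuous_blk k)
  have hP0 : 0 < (P 0).re := by
    have h0 : ∀ k : Fin N, blk (0 : EuclideanSpace ℝ (Fin N × Fin n)) k = 0 := fun k => by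
      ext i
      simp [blk]
    simpa [hPdef, h0] using hg
  obtain ⟨δ, hδ, hball⟩ := Metric.eventually_nhds_iff.1
    ((Complex.continuous_re.comp hP).continuousAt.eventually (lt_mem_nhds hP0))
  obtain ⟨ξ₀, hξ₀⟩ := exists_norm_eq (EuclideanSpace ℝ (Fin N × Fin n)) (c := δ / 2) (by positivity)
  let Φ : ContDiffBump ξ₀ := ⟨δ / 8, δ / 4, by positivity, by linarith⟩
  have hnear : ∀ ξ, Φ ξ ≠ 0 → ‖ξ - ξ₀‖ < δ / 4 := fun ξ h => by
    by_contra! hc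
    exact h (Φ.zero_of_le_dist (by rwa [dist_eq_norm]))
  refine ⟨Φ, Φ.contDiff, Φ.hasCompactSupport, ⟨δ / 4, by positivity, fun ξ hξ => ?_⟩, ?_⟩
  · by_contra h
    have h1 := hnear ξ h
    have h2 := norm_sub_norm_le ξ₀ ξ
    rw [norm_sub_rev] at h2
    linarith
  have hpos : 0 < ∫ ξ, Φ ξ * (P ξ).re := by
    refine Continuous.integral_pos_of_hasCompactSupport_nonneg_nonzero (x := ξ₀)
      (Φ.continuous.mul (Complex.continuous_re.comp hP)) Φ.hasCompactSupport.mul_right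
      (fun ξ => ?_) ?_
    · by_cases h : Φ ξ = 0
      · simp [h]
      · have h1 := hnear ξ h
        have h2 := norm_le_norm_add_norm_sub' ξ ξ₀
        exact mul_nonneg Φ.nonneg (hball (by rw [dist_zero_right]; linarith)).le
    · exact mul_ne_zero (Φ.pos_of_mem_ball (Metric.mem_ball_self Φ.rOut_pos)).ne'
        (hball (by rw [dist_zero_right]; linarith)).ne'
  have hre : (∫ ξ, (Φ ξ : ℂ) * P ξ).re = ∫ ξ, Φ ξ * (P ξ).re := by
    have h_int : Integrable fun ξ => (Φ ξ : ℂ) * P ξ :=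
      ((Complex.continuous_ofReal.comp Φ.continuous).mul hP).integrable_of_hasCompactSupport
        (Φ.hasCompactSupport.comp_left Complex.ofReal_zero).mul_right
    refine (integral_re h_int).symm.trans (integral_congr_ae (Filter.Eventually.of_forall ?_))
    intro ξ
    simp
  unfold Tm
  refine mul_ne_zero (inv_ne_zero (Complex.ofReal_ne_zero.2 (by positivity))) fun h => ?_
  simp only [inner_zero_left, Complex.ofReal_zero, mul_zero, Complex.exp_zero, one_mul] at h
  rw [h] at hre
  simp only [Complex.zero_re] at hre
  linarith

lemma exists_schwartz_bump (n : ℕ) :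
    ∃ g : SchwartzMap (EuclideanSpace ℝ (Fin n)) ℂ, HasCompactSupport g ∧
      ∀ N : ℕ, 0 < (fint g 0 ^ N).re := by
  let φ : ContDiffBump (0 : EuclideanSpace ℝ (Fin n)) := default
  have hc : HasCompactSupport fun x => (φ x : ℂ) :=
    φ.hasCompactSupport.comp_left Complex.ofReal_zero
  refine ⟨hc.toSchwartzMap (Complex.ofRealCLM.contDiff.comp φ.contDiff), hc, fun N => ?_⟩
  have h0 : fint (fun x => (φ x : ℂ)) 0 = ((∫ x, φ x : ℝ) : ℂ) := by
    simp [fint, integral_complex_ofReal]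
  change 0 < (fint (fun x => (φ x : ℂ)) 0 ^ N).re
  rw [h0, ← Complex.ofReal_pow, Complex.ofReal_re]
  exact pow_pos φ.integral_pos _

lemma wLp_lt_top {n : ℕ} {q : ℝ} (hq : 0 < q) {w : EuclideanSpace ℝ (Fin n) → ℝ}
    (hw : Continuous w) {g : EuclideanSpace ℝ (Fin n) → ℂ} (hg : Continuous g)
    (hgc : HasCompactSupport g) : wLp q w g < ⊤ := by
  refine ENNReal.rpow_lt_top_of_nonneg (by positivity) ?_
  have hc : HasCompactSupport fun x => ‖g x‖ ^ q * w x :=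
    (hgc.comp_left (g := fun z : ℂ => ‖z‖ ^ q)
      (by simp [Real.zero_rpow hq.ne'])).mul_right
  have h_int := ((hg.norm.rpow_const fun x => Or.inr hq.le).mul hw).integrable_of_hasCompactSupport
    (μ := volume) hc
  exact h_int.lintegral_lt_top.ne

lemma wLp_comp_sub_le {n : ℕ} {q γ : ℝ} (hq : 0 < q) (hγ : γ ≤ 0)
    (a : EuclideanSpace ℝ (Fin n)) (g : EuclideanSpace ℝ (Fin n) → ℂ) :
    wLp q (prodWeight γ) (fun x => g (x - a)) ≤
      ENNReal.ofReal (prodWeight (γ / q) a) * wLp q (prodWeight (-γ)) g := by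
  have h1 : ENNReal.ofReal (prodWeight (γ / q) a) =
      ENNReal.ofReal (prodWeight γ a) ^ (1 / q) := by
    rw [ENNReal.ofReal_rpow_of_pos (prodWeight_pos _ _), prodWeight_rpow, mul_one_div]
  unfold wLp
  rw [h1, ← ENNReal.mul_rpow_of_nonneg _ _ (by positivity : 0 ≤ 1 / q),
    ← lintegral_const_mul' _ _ ENNReal.ofReal_ne_top]
  refine ENNReal.rpow_le_rpow ?_ (by positivity)
  rw [← lintegral_sub_right_eq_self
    (fun x => ENNReal.ofReal (prodWeight γ a) * ENNReal.ofReal (‖g x‖ ^ q * prodWeight (-γ) x)) a]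
  refine lintegral_mono fun x => ?_
  rw [← ENNReal.ofReal_mul (prodWeight_pos _ _).le]
  refine ENNReal.ofReal_le_ofReal ?_
  calc ‖g (x - a)‖ ^ q * prodWeight γ x
      ≤ ‖g (x - a)‖ ^ q * (prodWeight γ a * prodWeight (-γ) (x - a)) := by
        gcongr
        exact prodWeight_sub_le hγ x a
    _ = _ := by ring

/-- The Sobolev norms of the dilated pieces of `e^{i a·ξ_{k₀}} Φ(ξ)` grow at most like
`(1 + ‖a‖) ^ t`, uniformly in the dilation. -/
lemma exists_sobolevProd_pieces_le {N n : ℕ} (k₀ : Fin N) {t : ℝ} (ht : 0 ≤ t)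
    {Φ : EuclideanSpace ℝ (Fin N × Fin n) → ℝ} (hΦ : ContDiff ℝ (⊤ : ℕ∞) Φ)
    (hΦc : HasCompactSupport Φ) {ρ : ℝ} (hρ : 0 < ρ) (hΦ0 : ∀ ξ, ‖ξ‖ < ρ → Φ ξ = 0)
    (Ψ : SchwartzMap (EuclideanSpace ℝ (Fin N × Fin n)) ℝ)
    (hΨ : tsupport ⇑Ψ ⊆ {ξ | 1 / 2 ≤ ‖ξ‖ ∧ ‖ξ‖ ≤ 2}) :
    ∃ K : ℝ, 0 ≤ K ∧ ∀ (a : EuclideanSpace ℝ (Fin n)) (j : ℤ),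
      sobolevProd (fun _ => t) (fun η =>
        (Complex.exp (Complex.I * ((⟪inclBlk k₀ a, (2 : ℝ) ^ j • η⟫ : ℝ) : ℂ)) *
          (Φ ((2 : ℝ) ^ j • η) : ℂ)) * (Ψ η : ℂ)) ≤
        ENNReal.ofReal (K * (1 + ‖a‖) ^ t) := by
  have hpiece : ∀ j : ℤ, ∃ K : ℝ, 0 ≤ K ∧ ∀ a : EuclideanSpace ℝ (Fin n),
      sobolevProd (fun _ => t) (fun η =>
        (Complex.exp (Complex.I * ((⟪inclBlk k₀ a, (2 : ℝ) ^ j • η⟫ : ℝ) : ℂ)) *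
          (Φ ((2 : ℝ) ^ j • η) : ℂ)) * (Ψ η : ℂ)) ≤
        ENNReal.ofReal (K * (1 + ‖a‖) ^ t) := by
    intro j
    have h2j : (0 : ℝ) < 2 ^ j := by positivity
    set D : ℝ := 2 * (1 + 2 ^ j) ^ 2 with hD
    have hD1 : 2 ≤ D := by nlinarith
    have hc : HasCompactSupport fun η => (Φ ((2 : ℝ) ^ j • η) : ℂ) * (Ψ η : ℂ) :=
      ((hΦc.comp_smul h2j.ne').comp_left Complex.ofReal_zero).mul_right
    have hd : ContDiff ℝ (⊤ : ℕ∞) fun η => (Φ ((2 : ℝ) ^ j • η) : ℂ) * (Ψ η : ℂ) :=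
      (Complex.ofRealCLM.contDiff.comp (hΦ.comp (contDiff_const_smul _))).mul
        (Complex.ofRealCLM.contDiff.comp (Ψ.smooth _))
    have hfin := sobolevProd_lt_top (t := fun _ => t) (fun _ => ht) (hc.toSchwartzMap hd)
    refine ⟨((D ^ t) ^ N) ^ ((1 : ℝ) / 2) *
      (sobolevProd (fun _ => t) (hc.toSchwartzMap hd)).toReal, by positivity, fun a => ?_⟩
    have h1 := sobolevProd_modulation_le (t := fun _ => t) (fun _ => ht)
      ((2 : ℝ) ^ j • inclBlk k₀ a) (hc.toSchwartzMap hd)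
    have h2 : ∏ k, (2 * (1 + ‖blk ((2 : ℝ) ^ j • inclBlk k₀ a) k‖ ^ 2)) ^ t ≤
        (D ^ t) ^ N * ((1 + ‖a‖) ^ t) ^ 2 := by
      have : (D ^ t) ^ N * ((1 + ‖a‖) ^ t) ^ 2 =
          ∏ k : Fin N, (D ^ t * if k = k₀ then ((1 + ‖a‖) ^ t) ^ 2 else 1) := by
        rw [Finset.prod_mul_distrib]
        simp
      rw [this]
      refine Finset.prod_le_prod (fun k _ => by positivity) fun k _ => ?_
      rw [blk_smul, blk_inclBlk]
      split_ifs with hk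
      · rw [← Real.rpow_mul_natCast (by positivity), mul_comm t, Real.rpow_mul (by positivity),
          ← Real.mul_rpow (by positivity) (by positivity)]
        refine Real.rpow_le_rpow (by positivity) ?_ ht
        rw [norm_smul, Real.norm_of_nonneg h2j.le, hD]
        push_cast
        rw [Real.rpow_two]
        have : (0 : ℝ) ≤ 2 ^ j * ‖a‖ := by positivity
        have : 1 + 2 ^ j * ‖a‖ ≤ (1 + 2 ^ j) * (1 + ‖a‖) := by nlinarith [norm_nonneg a]
        have : (1 + 2 ^ j * ‖a‖) ^ 2 ≤ ((1 + 2 ^ j) * (1 + ‖a‖)) ^ 2 := by gcongr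
        nlinarith
      · rw [mul_one]
        refine Real.rpow_le_rpow (by positivity) ?_ ht
        simpa using hD1
    have h3 : ENNReal.ofReal (∏ k, (2 * (1 + ‖blk ((2 : ℝ) ^ j • inclBlk k₀ a) k‖ ^ 2)) ^ t) ^
        ((1 : ℝ) / 2) ≤
        ENNReal.ofReal (((D ^ t) ^ N) ^ ((1 : ℝ) / 2) * (1 + ‖a‖) ^ t) := by
      rw [ENNReal.ofReal_rpow_of_nonneg (Finset.prod_nonneg fun k _ => by positivity)
        (by norm_num)]
      refine ENNReal.ofReal_le_ofReal ?_
      refine (Real.rpow_le_rpow (Finset.prod_nonneg fun k _ => by positivity) h2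
        (by norm_num)).trans_eq ?_
      rw [Real.mul_rpow (by positivity) (by positivity), ← Real.sqrt_eq_rpow (((1 + ‖a‖) ^ t) ^ 2),
        Real.sqrt_sq (by positivity)]
    calc _ = sobolevProd (fun _ => t) (fun η => Complex.exp (Complex.I *
            ((⟪(2 : ℝ) ^ j • inclBlk k₀ a, η⟫ : ℝ) : ℂ)) * hc.toSchwartzMap hd η) := by
          congr 1
          ext η
          rw [inner_smul_left, inner_smul_right, mul_assoc]
          rfl
      _ ≤ _ := h1
      _ ≤ ENNReal.ofReal (((D ^ t) ^ N) ^ ((1 : ℝ) / 2) * (1 + ‖a‖) ^ t) *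
            sobolevProd (fun _ => t) (hc.toSchwartzMap hd) := by gcongr
      _ = _ := by
          rw [← ENNReal.ofReal_toReal hfin.ne, ← ENNReal.ofReal_mul (by positivity),
            ENNReal.ofReal_toReal hfin.ne]
          congr 1
          ring
  choose K hK hle using hpiece
  obtain ⟨r, hr⟩ := hΦc.isCompact.isBounded.exists_norm_le
  obtain ⟨J₀, hJ₀⟩ := exists_pow_lt_of_lt_one (half_pos hρ) (by norm_num : (1 / 2 : ℝ) < 1)
  obtain ⟨J₁, hJ₁⟩ := pow_unbounded_of_one_lt (2 * r) (by norm_num : (1 : ℝ) < 2)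
  refine ⟨∑ j ∈ Finset.Icc (-(J₀ : ℤ)) J₁, K j, Finset.sum_nonneg fun j _ => hK j,
    fun a j => ?_⟩
  by_cases hj : j ∈ Finset.Icc (-(J₀ : ℤ)) J₁
  · refine (hle j a).trans (ENNReal.ofReal_le_ofReal ?_)
    gcongr
    exact Finset.single_le_sum (fun j _ => hK j) hj
  · have hzero : ∀ η, (Φ ((2 : ℝ) ^ j • η) : ℂ) * (Ψ η : ℂ) = 0 := fun η => by
      by_contra hne
      obtain ⟨hΦη, hΨη⟩ := mul_ne_zero_iff.1 hne
      rw [Complex.ofReal_ne_zero] at hΦη hΨη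
      have h1 := hΨ (subset_tsupport _ hΨη)
      have h2 := hr _ (subset_tsupport _ hΦη)
      have h3 : ρ ≤ ‖(2 : ℝ) ^ j • η‖ := by
        by_contra! hlt
        exact hΦη (hΦ0 _ hlt)
      have h2j : (0 : ℝ) < 2 ^ j := by positivity
      rw [norm_smul, Real.norm_of_nonneg h2j.le] at h2 h3
      refine hj (Finset.mem_Icc.2 ⟨?_, ?_⟩)
      · have : (2 : ℝ) ^ (-(J₀ : ℤ)) < 2 ^ j := by
          rw [zpow_neg, zpow_natCast, ← inv_pow, inv_eq_one_div]
          nlinarith [h1.2]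
        exact ((zpow_lt_zpow_iff_right₀ (by norm_num : (1 : ℝ) < 2)).1 this).le
      · have : (2 : ℝ) ^ j < 2 ^ (J₁ : ℤ) := by
          rw [zpow_natCast]
          nlinarith [h1.1]
        exact ((zpow_lt_zpow_iff_right₀ (by norm_num : (1 : ℝ) < 2)).1 this).le
    simp only [mul_assoc, hzero, mul_zero, sobolevProd_zero]
    exact bot_le

lemma ENNReal.eq_zero_of_le_ofReal_rpow_neg_mul {L M : ℝ≥0∞} {δ : ℝ} (hδ : 0 < δ) (hM : M ≠ ⊤)
    (h : ∀ R : ℝ, 0 ≤ R → L ≤ ENNReal.ofReal ((1 + R) ^ (-δ)) * M) : L = 0 := by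
  have h1 : Filter.Tendsto (fun R : ℝ => (1 + R) ^ (-δ)) Filter.atTop (nhds 0) :=
    (tendsto_rpow_neg_atTop hδ).comp (Filter.tendsto_atTop_add_const_left _ 1 Filter.tendsto_id)
  have h2 := ENNReal.Tendsto.mul_const (ENNReal.tendsto_ofReal h1) (Or.inr hM)
  rw [ENNReal.ofReal_zero, zero_mul] at h2
  have h3 := ge_of_tendsto h2 (Filter.eventually_ge_atTop (0 : ℝ) |>.mono h)
  exact le_antisymm h3 bot_le

lemma exists_isMultiAp_prodWeight {n N : ℕ} {q : ℝ} {r : Fin N → ℝ} (hr : ∀ k, 1 < r k)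
    (hq : 1 / q = ∑ k, 1 / r k) {k₀ k₁ : Fin N} (hk : k₀ ≠ k₁) :
    ∃ β : Fin N → ℝ, β k₀ = -r k₀ - 1 / 4 ∧ IsMultiAp n N q r fun k => prodWeight (β k) := by
  have hr0 : ∀ k, 0 < r k := fun k => by linarith [hr k]
  have hsum : 1 / r k₀ + 1 / r k₁ ≤ 1 / q := by
    rw [hq, ← Finset.sum_pair hk (f := fun k => 1 / r k)]
    exact Finset.sum_le_univ_sum_of_nonneg fun k => (one_div_pos.2 (hr0 k)).le
  have hk0 : 0 < 1 / r k₀ := one_div_pos.2 (hr0 k₀)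
  have hk1 : 0 < 1 / r k₁ := one_div_pos.2 (hr0 k₁)
  have hq0 : 0 < q := one_div_pos.1 (by linarith)
  refine ⟨fun k => if k = k₀ then -r k₀ - 1 / 4 else
    if k = k₁ then r k₁ - 1 - r k₁ / (4 * r k₀) else 0, if_pos rfl,
    isMultiAp_prodWeight hq0 hr ?_ fun k => ?_⟩
  · rw [Fintype.sum_eq_add k₀ k₁ hk fun k hk' => by simp [hk'.1, hk'.2], if_pos rfl,
      if_neg hk.symm, if_pos rfl]
    have h1 : (-r k₀ - 1 / 4) * (q / r k₀) + (r k₁ - 1 - r k₁ / (4 * r k₀)) * (q / r k₁) =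
        -(q * (1 / r k₁ + 1 / 2 * (1 / r k₀))) := by
      have := (hr0 k₀).ne'
      have := (hr0 k₁).ne'
      field_simp
      ring
    have h2 : q * (1 / r k₁ + 1 / 2 * (1 / r k₀)) < q * (1 / q) :=
      mul_lt_mul_of_pos_left (by linarith) hq0
    rw [mul_one_div_cancel hq0.ne'] at h2
    rw [h1]
    linarith
  · have h1 : 0 < r k - 1 := by linarith [hr k]
    have h2 : 1 - r k / (r k - 1) = -(1 / (r k - 1)) := by
      field_simp
      ring
    have h3 : 0 < 1 / (r k - 1) := one_div_pos.2 h1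
    rw [h2]
    split_ifs with h h'
    · subst h
      nlinarith [hr0 k]
    · subst h'
      have h4 : (r k - 1 - r k / (4 * r k₀)) * -(1 / (r k - 1)) =
          -1 + r k / (4 * r k₀) * (1 / (r k - 1)) := by
        field_simp
        ring
      have : 0 < r k / (4 * r k₀) * (1 / (r k - 1)) :=
        mul_pos (div_pos (hr0 k) (by linarith [hr0 k₀])) h3
      linarith
    · linarith

/-- Let `N ≥ 2`, `n ≥ 1`, `Nn/2 < s ≤ Nn`, `Nn/s < p_k < ∞`,
`1/p = 1/p₁ + ⋯ + 1/p_N`, and `q_k = p_k s/(Nn)`.  Then there exist nonnegative weights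
`w₁,…,w_N` with `(w₁,…,w_N) ∈ A_{(q₁,…,q_N)}` such that for every `Ψ ∈ 𝒮(ℝ^{Nn})`
supported in `{1/2 ≤ |ξ| ≤ 2}` with `Σ_{k∈ℤ} Ψ(ξ/2^k) = 1` for `ξ ≠ 0`, there is no
constant `C > 0` such that for all bounded measurable `m` and all Schwartz `f₁,…,f_N`,
`‖T_m(f⃗)‖_{L^{p,∞}(ν_w)} ≤ C · (sup_{j∈ℤ} ‖m(2^j·)Ψ‖_{W^{(s/N,…,s/N)}}) · Π_k ‖f_k‖_{L^{p_k}(w_k)}`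
(the supremum over `j` is encoded through an arbitrary upper bound `A` of all the
product-type Sobolev norms of the pieces `m_j`; the weak norm is spelled out through its defining inequality for every `λ > 0`). -/
theorem stmt_1 (N n : ℕ) (hN : 2 ≤ N) (hn : 1 ≤ n) (s p : ℝ) (pk : Fin N → ℝ)
    (hs1 : (N * n : ℝ) / 2 < s) (hs2 : s ≤ (N * n : ℝ))
    (hpk : ∀ k, (N * n : ℝ) / s < pk k)
    (hp : 1 / p = ∑ k, 1 / pk k) :
    ∃ w : Fin N → EuclideanSpace ℝ (Fin n) → ℝ,
      (∀ k x, 0 ≤ w k x) ∧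
      IsMultiAp n N (p * s / (N * n)) (fun k => pk k * s / (N * n)) w ∧
      ∀ Ψ : SchwartzMap (EuclideanSpace ℝ (Fin N × Fin n)) ℝ,
        tsupport ⇑Ψ ⊆ {ξ | 1 / 2 ≤ ‖ξ‖ ∧ ‖ξ‖ ≤ 2} →
        (∀ ξ : EuclideanSpace ℝ (Fin N × Fin n), ξ ≠ 0 →
          ∑' j : ℤ, Ψ (((2 : ℝ) ^ j)⁻¹ • ξ) = 1) →
        ¬ ∃ C : ℝ, 0 < C ∧
          ∀ m : EuclideanSpace ℝ (Fin N × Fin n) → ℂ,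
            Measurable m → (∃ B : ℝ, ∀ ξ, ‖m ξ‖ ≤ B) →
          ∀ A : ℝ,
            (∀ j : ℤ, sobolevProd (fun _ => s / N)
                (fun η => m ((2 : ℝ) ^ j • η) * (Ψ η : ℂ)) ≤ ENNReal.ofReal A) →
          ∀ f : Fin N → SchwartzMap (EuclideanSpace ℝ (Fin n)) ℂ,
            ∀ lam : ℝ, 0 < lam →
              ENNReal.ofReal lam *
                  (∫⁻ x in {x : EuclideanSpace ℝ (Fin n) |
                      lam < ‖Tm m (fun k => ⇑(f k)) x‖},
                    ENNReal.ofReal (∏ k, w k x ^ (p / pk k))) ^ (1 / p)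
                ≤ ENNReal.ofReal C * ENNReal.ofReal A * ∏ k, wLp (pk k) (w k) ⇑(f k) := by
  have hNpos : (0 : ℝ) < N := by exact_mod_cast (by omega : 0 < N)
  have hnpos : (0 : ℝ) < n := by exact_mod_cast (by omega : 0 < n)
  have hNn : (0 : ℝ) < N * n := mul_pos hNpos hnpos
  have hs : 0 < s := by linarith
  have hpk0 : ∀ k, 0 < pk k := fun k => lt_trans (by positivity) (hpk k)
  let k₀ : Fin N := ⟨0, by omega⟩
  let k₁ : Fin N := ⟨1, by omega⟩
  have hk : k₀ ≠ k₁ := by simp [k₀, k₁]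
  have hr : ∀ k, 1 < pk k * s / (N * n) := fun k => by
    rw [one_lt_div hNn, ← div_lt_iff₀ hs]
    exact hpk k
  have hp0 : 0 < 1 / p := by
    rw [hp]
    exact Finset.sum_pos (fun k _ => one_div_pos.2 (hpk0 k)) ⟨k₀, Finset.mem_univ _⟩
  have hq : 1 / (p * s / (N * n)) = ∑ k, 1 / (pk k * s / (N * n)) := by
    have h1 : ∀ x : ℝ, 1 / (x * s / (N * n)) = 1 / x * (N * n / s) := fun x => by
      rw [one_div_div, div_mul_div_comm, one_mul]
    simp only [h1]
    rw [← Finset.sum_mul, ← hp]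
  obtain ⟨β, hβ, hAp⟩ := exists_isMultiAp_prodWeight (n := n) hr hq hk
  refine ⟨fun k => prodWeight (β k), fun k x => (prodWeight_pos _ _).le, hAp, ?_⟩
  rintro Ψ hΨ - ⟨C, -, hC⟩
  have hβ0 : β k₀ ≤ 0 := by linarith [hr k₀]
  obtain ⟨g, hgc, hg⟩ := exists_schwartz_bump n
  obtain ⟨Φ, hΦ, hΦc, ⟨ρ, hρ, hΦ0⟩, hT⟩ :=
    exists_cutoff_Tm_ne_zero (N := N) (by omega) (by omega) g (hg N)
  have ht : 0 ≤ s / N := by positivity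
  obtain ⟨K, hK, hKle⟩ := exists_sobolevProd_pieces_le k₀ ht hΦ hΦc hρ hΦ0 Ψ hΨ
  obtain ⟨B, hB⟩ := hΦc.exists_bound_of_continuous hΦ.continuous
  set F := Tm (fun ξ => (Φ ξ : ℂ)) (fun _ : Fin N => ⇑g) with hF
  have hFc : Continuous F :=
    continuous_Tm (Complex.continuous_ofReal.comp hΦ.continuous)
      (hΦc.comp_left Complex.ofReal_zero) fun _ => g
  have hlam : 0 < ‖F 0‖ / 2 := half_pos (norm_pos_iff.2 hT)
  set S : Set (EuclideanSpace ℝ (Fin n)) := {x | ‖F 0‖ / 2 < ‖F x‖} with hS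
  have hSo : IsOpen S := isOpen_lt continuous_const hFc.norm
  have hL : ENNReal.ofReal (‖F 0‖ / 2) *
      (∫⁻ x in S, ENNReal.ofReal (∏ k, prodWeight (β k) x ^ (p / pk k))) ^ (1 / p) ≠ 0 := by
    refine mul_ne_zero (ENNReal.ofReal_pos.2 hlam).ne' ?_
    rw [ne_eq, ENNReal.rpow_eq_zero_iff_of_pos hp0]
    refine ne_of_gt ?_
    have hmeas : Measurable fun x : EuclideanSpace ℝ (Fin n) =>
        ENNReal.ofReal (∏ k, prodWeight (β k) x ^ (p / pk k)) := by
      simp only [prodWeight_rpow, prod_prodWeight]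
      exact ENNReal.measurable_ofReal.comp (continuous_prodWeight _).measurable
    rw [setLIntegral_pos_iff hmeas]
    have hsupp : Function.support (fun x : EuclideanSpace ℝ (Fin n) =>
        ENNReal.ofReal (∏ k, prodWeight (β k) x ^ (p / pk k))) = Set.univ := by
      ext x
      simp only [prodWeight_rpow, prod_prodWeight, Function.mem_support, Set.mem_univ, iff_true]
      exact (ENNReal.ofReal_pos.2 (prodWeight_pos _ _)).ne'
    rw [hsupp, Set.univ_inter]
    exact hSo.measure_pos volume ⟨0, by simp only [hS, Set.mem_ofPred_eq]; linarith⟩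
  set W : ℝ≥0∞ := wLp (pk k₀) (prodWeight (-β k₀)) g *
    ∏ k ∈ Finset.univ.erase k₀, wLp (pk k) (prodWeight (β k)) g with hW
  have hWtop : W ≠ ⊤ := ENNReal.mul_ne_top
    (wLp_lt_top (hpk0 _) (continuous_prodWeight _) g.continuous hgc).ne
    (ENNReal.prod_ne_top fun k _ =>
      (wLp_lt_top (hpk0 _) (continuous_prodWeight _) g.continuous hgc).ne)
  refine hL (ENNReal.eq_zero_of_le_ofReal_rpow_neg_mul (δ := n / (4 * pk k₀))
    (M := ENNReal.ofReal C * ENNReal.ofReal (K * (1 + √n) ^ (s / N)) * W)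
    (div_pos hnpos (by linarith [hpk0 k₀]))
    (ENNReal.mul_ne_top (ENNReal.mul_ne_top ENNReal.ofReal_ne_top ENNReal.ofReal_ne_top) hWtop)
    fun R hR => ?_)
  set a : EuclideanSpace ℝ (Fin n) := WithLp.toLp 2 fun _ => R with ha
  have hanorm : ‖a‖ = √n * R := by
    rw [EuclideanSpace.norm_eq]
    simp [ha, Real.sqrt_sq hR]
  have haweight : ∀ γ : ℝ, prodWeight γ a = (1 + R) ^ (γ * n) := fun γ => by
    simp [prodWeight, ha, abs_of_nonneg hR, Real.rpow_mul_natCast (by positivity : 0 ≤ 1 + R)]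
  have hf : (fun k => ⇑(if k = k₀ then g.compSubConstCLM ℂ a else g)) =
      fun k : Fin N => if k = k₀ then fun y => g (y - a) else ⇑g := by
    funext k
    split_ifs <;> rfl
  have hprod : ∏ k, wLp (pk k) (prodWeight (β k))
      (if k = k₀ then fun y => g (y - a) else ⇑g) ≤
      ENNReal.ofReal ((1 + R) ^ (β k₀ / pk k₀ * n)) * W := by
    rw [← Finset.mul_prod_erase _ _ (Finset.mem_univ k₀), if_pos rfl, hW, ← mul_assoc,
      ← haweight]
    refine mul_le_mul' (wLp_comp_sub_le (hpk0 k₀) hβ0 a g)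
      (Finset.prod_congr rfl fun k hk' => ?_).le
    rw [if_neg (Finset.ne_of_mem_erase hk')]
  have hcont : Continuous fun ξ : EuclideanSpace ℝ (Fin N × Fin n) =>
      Complex.exp (Complex.I * ((⟪inclBlk k₀ a, ξ⟫ : ℝ) : ℂ)) * (Φ ξ : ℂ) := by
    have := hΦ.continuous
    fun_prop
  have hmain := hC
    (fun ξ => Complex.exp (Complex.I * ((⟪inclBlk k₀ a, ξ⟫ : ℝ) : ℂ)) * (Φ ξ : ℂ))
    hcont.measurable ⟨B, fun ξ => by
      rw [norm_mul, mul_comm Complex.I, Complex.norm_exp_ofReal_mul_I, one_mul,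
        Complex.norm_real]
      exact hB ξ⟩
    (K * (1 + √n) ^ (s / N) * (1 + R) ^ (s / N))
    (fun j => (hKle a j).trans (ENNReal.ofReal_le_ofReal (by
      rw [mul_assoc, ← Real.mul_rpow (by positivity) (by positivity), hanorm]
      gcongr
      nlinarith [Real.sqrt_nonneg n])))
    (fun k => if k = k₀ then g.compSubConstCLM ℂ a else g) (‖F 0‖ / 2) hlam
  have hTm : ∀ x, Tm
      (fun ξ => Complex.exp (Complex.I * ((⟪inclBlk k₀ a, ξ⟫ : ℝ) : ℂ)) * (Φ ξ : ℂ))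
      (fun k => ⇑(if k = k₀ then g.compSubConstCLM ℂ a else g)) x = F x := fun x => by
    rw [hf, Tm_modulation, hF]
  simp only [hTm] at hmain
  refine hmain.trans ?_
  have hprod' : ∏ k, wLp (pk k) (prodWeight (β k))
      ⇑(if k = k₀ then g.compSubConstCLM ℂ a else g) ≤
      ENNReal.ofReal ((1 + R) ^ (β k₀ / pk k₀ * n)) * W := by
    refine le_of_eq_of_le (Finset.prod_congr rfl fun k _ => ?_) hprod
    rw [← congrFun hf k]
  have hexp : (1 + R) ^ (s / N) * (1 + R) ^ (β k₀ / pk k₀ * n) =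
      (1 + R) ^ (-(n / (4 * pk k₀))) := by
    rw [← Real.rpow_add (by positivity), hβ]
    congr 1
    have := (hpk0 k₀).ne'
    field_simp
    ring
  calc _ ≤ ENNReal.ofReal C * ENNReal.ofReal (K * (1 + √n) ^ (s / N) * (1 + R) ^ (s / N)) *
        (ENNReal.ofReal ((1 + R) ^ (β k₀ / pk k₀ * n)) * W) := by gcongr
    _ = ENNReal.ofReal ((1 + R) ^ (s / N) * (1 + R) ^ (β k₀ / pk k₀ * n)) *
        (ENNReal.ofReal C * ENNReal.ofReal (K * (1 + √n) ^ (s / N)) * W) := by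
        rw [ENNReal.ofReal_mul (by positivity : 0 ≤ K * (1 + √n) ^ (s / N)),
          ENNReal.ofReal_mul (by positivity : 0 ≤ (1 + R) ^ (s / N))]
        ring
    _ = _ := by rw [hexp]

end
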